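/- arXiv:2602.01412 — 2 statements merged into one kernel-verified Lean document; each statement's English description precedes it below -/
import Mathlib

section
/- For every real number r > 0 and every positive integer k, the difference between log r and its k-th order Taylor polynomial around 1 satisfies | log r − Σ_{i=1}^{k} (−1)^{i−1} (r−1)^i / i | ≤ (|r−1|^{k+1}/(k+1)) · (1 + 1/r). -/
lemma hasDerivAt_log_sub_taylor (k : ℕ) {x : ℝ} (hx : x ≠ 0) :
    HasDerivAt (fun y : ℝ => Real.log y -
      ∑ i ∈ Finset.Icc 1 k, (-1 : ℝ) ^ (i - 1) * (y - 1) ^ i / (i : ℝ))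
      ((1 - x) ^ k / x) x := by
  induction k with
  | zero => simpa using Real.hasDerivAt_log hx
  | succ k ih =>
    have hterm : HasDerivAt (fun y : ℝ => (-1 : ℝ) ^ k * (y - 1) ^ (k + 1) / ((k + 1 : ℕ) : ℝ))
        ((1 - x) ^ k) x := by
      have h := ((((hasDerivAt_id x).sub_const 1).pow (k + 1)).const_mul
        ((-1 : ℝ) ^ k)).div_const ((k + 1 : ℕ) : ℝ)
      refine h.congr_deriv ?_
      have hk : ((k + 1 : ℕ) : ℝ) ≠ 0 := by positivity
      have hpow : (1 - x) ^ k = (-1 : ℝ) ^ k * (x - 1) ^ k := by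
        rw [← mul_pow]
        ring
      rw [hpow, div_eq_iff hk]
      simp only [id, Nat.add_sub_cancel]
      ring
    refine ((ih.sub hterm).congr_deriv ?_).congr_of_eventuallyEq (.of_forall fun y => ?_)
    · field_simp
      ring
    · simp only [Pi.sub_apply]
      rw [Finset.sum_Icc_succ_top (by omega), Nat.add_sub_cancel]
      ring

/-- Lemma `LogTaylorBound`: for every real `r > 0` and every positive integer `k`,
the difference between `log r` and its `k`-th order Taylor polynomial around `1` satisfies
`|log r − ∑_{i=1}^{k} (−1)^{i−1} (r−1)^i / i| ≤ (|r−1|^{k+1}/(k+1)) · (1 + 1/r)`. -/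
theorem logTaylorBound (r : ℝ) (hr : 0 < r) (k : ℕ) (hk : 0 < k) :
    |Real.log r - ∑ i ∈ Finset.Icc 1 k, (-1 : ℝ) ^ (i - 1) * (r - 1) ^ i / (i : ℝ)| ≤
      |r - 1| ^ (k + 1) / ((k : ℝ) + 1) * (1 + 1 / r) := by
  have hpos : ∀ x ∈ Set.uIcc 1 r, 0 < x := fun x hx => (lt_min one_pos hr).trans_le hx.1
  have hint : IntervalIntegrable (fun x : ℝ => (1 - x) ^ k / x) MeasureTheory.volume 1 r :=
    ContinuousOn.intervalIntegrable <|
      ContinuousOn.div (by fun_prop) continuousOn_id fun x hx => (hpos x hx).ne'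
  have hftc := intervalIntegral.integral_eq_sub_of_hasDerivAt
    (fun x hx => hasDerivAt_log_sub_taylor k (hpos x hx).ne') hint
  have hone : ∑ i ∈ Finset.Icc 1 k, (-1 : ℝ) ^ (i - 1) * (1 - 1) ^ i / (i : ℝ) = 0 :=
    Finset.sum_eq_zero fun i hi => by
      have : i ≠ 0 := by have := (Finset.mem_Icc.mp hi).1; omega
      simp [this]
  rw [hone, Real.log_one, sub_zero, sub_zero] at hftc
  rw [← hftc, ← integral_pow_abs_sub_uIoc, ← MeasureTheory.integral_mul_const,
    ← Real.norm_eq_abs]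
  refine intervalIntegral.norm_integral_le_integral_norm_uIoc.trans ?_
  refine MeasureTheory.setIntegral_mono_on hint.def'.norm ?_ measurableSet_uIoc fun x hx => ?_
  · exact (Continuous.intervalIntegrable (by fun_prop) 1 r).def'
  · have hx0 := hpos x (Set.uIoc_subset_uIcc hx)
    rw [Real.norm_eq_abs, abs_div, abs_pow, abs_sub_comm, abs_of_pos hx0, div_eq_mul_one_div]
    gcongr
    rcases min_le_iff.mp hx.1.le with h | h
    · have := one_div_le_one_div_of_le one_pos h
      have : 0 < 1 / r := by positivity
      linarith
    · have := one_div_le_one_div_of_le hr h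
      linarith
end

section
/- (Gaussian closed-form identity, eq. (VarOneGaussExample) in the appendix's Gaussian example.) Let d be a positive integer, θ, φ ∈ ℝ^d, α ∈ [0,1), and fix a coordinate k ∈ {1,…,d}. Let ξ be a standard Gaussian random vector on ℝ^d (i.i.d. standard normal coordinates). Define the normalized weight U = exp( −(1−α)⟨ξ, φ−θ⟩ − (1−α)²‖φ−θ‖²/2 ) (so that E(U) = 1; U equals w(z;x)^{1−α}/E(w(z;x)^{1−α}) for z = φ + ξ ~ N(φ, I_d), p_θ(z|x) = N(z; θ, I_d), q_φ(z|x) = N(z; φ, I_d)) and the score coordinate G = ξ_k = ∂_{φ_k} log q_φ(z|x). Then V( U·( G − E(U·G) ) ) = exp( (1−α)²‖θ−φ‖² ) · ( 1 + (1−α)²(φ_k − θ_k)² ). -/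
open MeasureTheory ProbabilityTheory Real

/-- Cameron–Martin shift in dimension one: tilting `N(0, 1)` by `t` gives `N(t, 1)`. -/
lemma integral_exp_tilt_gaussianReal (t : ℝ) (g : ℝ → ℝ) :
    ∫ x, Real.exp (t * x - t ^ 2 / 2) * g x ∂(gaussianReal 0 1) = ∫ x, g x ∂(gaussianReal t 1) := by
  rw [integral_gaussianReal_eq_integral_smul one_ne_zero,
    integral_gaussianReal_eq_integral_smul one_ne_zero]
  refine integral_congr_ae (.of_forall fun x => ?_)
  simp only [gaussianPDFReal, smul_eq_mul, NNReal.coe_one]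
  rw [mul_assoc, mul_assoc, ← mul_assoc (Real.exp _) (Real.exp _), ← Real.exp_add]
  ring_nf

/-- Cameron–Martin shift of a standard Gaussian vector, tested on a function of one coordinate. -/
lemma integral_exp_tilt_pi_gaussianReal {ι : Type*} [Fintype ι] (t : ι → ℝ) (k : ι) (g : ℝ → ℝ) :
    ∫ x, Real.exp (∑ i, t i * x i - (∑ i, t i ^ 2) / 2) * g (x k)
        ∂(Measure.pi fun _ : ι => gaussianReal 0 1) = ∫ x, g x ∂(gaussianReal (t k) 1) := by
  classical
  have hprod (x : ι → ℝ) : Real.exp (∑ i, t i * x i - (∑ i, t i ^ 2) / 2) * g (x k) =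
      ∏ i, Real.exp (t i * x i - t i ^ 2 / 2) * (if i = k then g (x i) else 1) := by
    rw [Finset.prod_mul_distrib, ← Real.exp_sum, Finset.sum_sub_distrib, Finset.sum_div,
      Finset.prod_ite_eq' Finset.univ k fun i => g (x i)]
    simp
  simp_rw [hprod]
  rw [integral_fintype_prod_eq_prod
    (f := fun i y => Real.exp (t i * y - t i ^ 2 / 2) * (if i = k then g y else 1))]
  simp_rw [integral_exp_tilt_gaussianReal]
  rw [Finset.prod_eq_single k (fun i _ hi => by simp [hi]) (by simp)]
  simp

lemma integral_sub_const_gaussianReal (m c : ℝ) : ∫ x, (x - c) ∂(gaussianReal m 1) = m - c := by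
  have hid : Integrable (fun x : ℝ => x) (gaussianReal m 1) :=
    (memLp_id_gaussianReal 1).integrable (by simp)
  rw [integral_sub hid (integrable_const c)]
  simp [integral_id_gaussianReal]

lemma integral_sub_const_sq_gaussianReal (m c : ℝ) :
    ∫ x, (x - c) ^ 2 ∂(gaussianReal m 1) = 1 + (m - c) ^ 2 := by
  have h := variance_eq_sub ((memLp_id_gaussianReal (μ := m) (v := 1) 2).sub (memLp_const c))
  have hv : Var[id - (fun _ => c); gaussianReal m 1] = 1 :=
    (variance_sub_const (by fun_prop) c).trans (by simp [variance_id_gaussianReal])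
  have he : ∫ x, (id - fun _ => c : ℝ → ℝ) x ∂(gaussianReal m 1) = m - c :=
    integral_sub_const_gaussianReal m c
  rw [hv, he] at h
  simp only [Pi.pow_apply, Pi.sub_apply, id_eq] at h
  linarith

/-- Variance of the exponentially weighted, centred coordinate of a standard Gaussian vector. -/
lemma variance_exp_tilt_mul_sub {ι Ω : Type*} [Fintype ι] [MeasurableSpace Ω] {P : Measure Ω}
    {ξ : Ω → ι → ℝ} (hξmeas : Measurable ξ)
    (hξ : Measure.map ξ P = Measure.pi fun _ : ι => gaussianReal 0 1) (t : ι → ℝ) (k : ι) :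
    variance (fun ω => Real.exp (∑ i, t i * ξ ω i - (∑ i, t i ^ 2) / 2) *
        (ξ ω k - ∫ ω', Real.exp (∑ i, t i * ξ ω' i - (∑ i, t i ^ 2) / 2) * ξ ω' k ∂P)) P =
      Real.exp (∑ i, t i ^ 2) * (1 + t k ^ 2) := by
  have key (s : ι → ℝ) (g : ℝ → ℝ) (hg : Measurable g) :
      ∫ ω, Real.exp (∑ i, s i * ξ ω i - (∑ i, s i ^ 2) / 2) * g (ξ ω k) ∂P =
        ∫ x, g x ∂(gaussianReal (s k) 1) := by
    rw [← integral_exp_tilt_pi_gaussianReal, ← hξ, integral_map hξmeas.aemeasurable]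
    exact Measurable.aestronglyMeasurable (by fun_prop)
  have hmean : ∫ ω, Real.exp (∑ i, t i * ξ ω i - (∑ i, t i ^ 2) / 2) * ξ ω k ∂P = t k :=
    (key t (fun x => x) measurable_id).trans integral_id_gaussianReal
  have hcentred : ∫ ω, Real.exp (∑ i, t i * ξ ω i - (∑ i, t i ^ 2) / 2) * (ξ ω k - t k) ∂P = 0 := by
    rw [key t (fun x => x - t k) (by fun_prop), integral_sub_const_gaussianReal, sub_self]
  have hsq (ω : Ω) :
      (Real.exp (∑ i, t i * ξ ω i - (∑ i, t i ^ 2) / 2) * (ξ ω k - t k)) ^ 2 =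
        Real.exp (∑ i, t i ^ 2) *
          (Real.exp (∑ i, 2 * t i * ξ ω i - (∑ i, (2 * t i) ^ 2) / 2) * (ξ ω k - t k) ^ 2) := by
    rw [mul_pow, ← mul_assoc, ← Real.exp_add, ← Real.exp_nat_mul]
    simp_rw [mul_pow, mul_assoc, ← Finset.mul_sum]
    push_cast
    ring_nf
  rw [hmean, variance_eq_integral (by fun_prop), hcentred]
  simp_rw [sub_zero, hsq]
  rw [integral_const_mul, key (fun i => 2 * t i) (fun x => (x - t k) ^ 2) (by fun_prop),
    integral_sub_const_sq_gaussianReal]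
  ring

/-- Gaussian closed-form identity (eq. (VarOneGaussExample)): for a standard Gaussian vector
`ξ` on `ℝ^d`, with normalized weight
`U = exp(−(1−α)⟨ξ, φ−θ⟩ − (1−α)²‖φ−θ‖²/2)` and score coordinate `G = ξ_k`,
`V(U·(G − E(U·G))) = exp((1−α)²‖θ−φ‖²)·(1 + (1−α)²(φ_k − θ_k)²)`. -/
theorem gaussian_var_identity
    (d : ℕ) (hd : 0 < d) (θ φ : Fin d → ℝ) (α : ℝ) (hα0 : 0 ≤ α) (hα1 : α < 1) (k : Fin d)
    {Ω : Type*} [MeasurableSpace Ω] (P : Measure Ω) [IsProbabilityMeasure P]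
    (ξ : Ω → (Fin d → ℝ)) (hξmeas : Measurable ξ)
    (hξ : Measure.map ξ P = Measure.pi fun _ : Fin d => gaussianReal 0 1) :
    variance (fun ω =>
        Real.exp (-(1 - α) * (∑ i, ξ ω i * (φ i - θ i))
            - (1 - α) ^ 2 * (∑ i, (φ i - θ i) ^ 2) / 2) *
          (ξ ω k - ∫ ω', Real.exp (-(1 - α) * (∑ i, ξ ω' i * (φ i - θ i))
            - (1 - α) ^ 2 * (∑ i, (φ i - θ i) ^ 2) / 2) * ξ ω' k ∂P)) P
      = Real.exp ((1 - α) ^ 2 * ∑ i, (θ i - φ i) ^ 2) *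
          (1 + (1 - α) ^ 2 * (φ k - θ k) ^ 2) := by
  have hU (x : Fin d → ℝ) : -(1 - α) * (∑ i, x i * (φ i - θ i)) -
        (1 - α) ^ 2 * (∑ i, (φ i - θ i) ^ 2) / 2 =
      ∑ i, -(1 - α) * (φ i - θ i) * x i - (∑ i, (-(1 - α) * (φ i - θ i)) ^ 2) / 2 := by
    simp_rw [mul_pow, neg_sq, Finset.mul_sum, mul_assoc, mul_comm (x _)]
  simp_rw [hU]
  rw [variance_exp_tilt_mul_sub hξmeas hξ (fun i => -(1 - α) * (φ i - θ i)) k]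
  simp_rw [mul_pow, neg_sq, ← Finset.mul_sum, sub_sq_comm (φ _) (θ _)]
end
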